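/- Let 0 < α₁ < 1, c₁ > 0, and let ρ : (0,1] → [0,∞) be measurable with ρ(x) ≥ 1/(c₁ x^{1+α₁}) for almost every x ∈ (0,1]. Then for every real z with |z| ≥ 1, ∫₀^1 (1 − cos(zx)) ρ(x) dx ≥ |z|^{α₁}/(8c₁). In particular, for the pure-jump subordinator exponent ψ(z) = ∫₀^1 (1 − e^{izx}) ρ(x) dx one has A(z) = 1 + Re ψ(z) ≥ |z|^{α₁}/(8c₁) for |z| ≥ 1. -/

import Mathlib

open MeasureTheory Filter Set

noncomputable section

/-- The pure-jump subordinator exponent `ψ(z) = ∫₀¹ (1 − e^{izx}) ρ(x) dx` of a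
Lévy density `ρ` on `(0,1]`. -/
def subExp (ρ : ℝ → ℝ) (z : ℝ) : ℂ :=
  ∫ x in Set.Ioc (0 : ℝ) 1, (1 - Complex.exp (Complex.I * ((z * x : ℝ) : ℂ))) * ((ρ x : ℝ) : ℂ)

/-- A quadratic lower bound for `1 - cos u` near the origin. -/
lemma sq_div_four_le_one_sub_cos {u : ℝ} (hu : |u| ≤ 1) : u ^ 2 / 4 ≤ 1 - Real.cos u := by
  have h := (abs_le.mp (Real.cos_bound hu)).2
  have h2 : u ^ 2 ≤ 1 := (sq_le_one_iff_abs_le_one u).mpr hu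
  have h4 : |u| ^ 4 = u ^ 2 * u ^ 2 := by rw [← sq_abs]; ring
  rw [h4] at h
  nlinarith [sq_nonneg u]

/-- The integrand of `subExp` is integrable as soon as `x * ρ x` is. -/
lemma integrableOn_subExp {ρ : ℝ → ℝ} (hmeas : Measurable ρ)
    (hnn : ∀ x ∈ Set.Ioc (0 : ℝ) 1, 0 ≤ ρ x)
    (hint : IntegrableOn (fun x => x * ρ x) (Set.Ioc (0 : ℝ) 1)) (z : ℝ) :
    IntegrableOn
      (fun x : ℝ => (1 - Complex.exp (Complex.I * ((z * x : ℝ) : ℂ))) * ((ρ x : ℝ) : ℂ))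
      (Set.Ioc (0 : ℝ) 1) := by
  refine Integrable.mono' (hint.const_mul |z|) (by fun_prop) ?_
  filter_upwards [ae_restrict_mem measurableSet_Ioc] with x hx
  have h := Real.norm_exp_I_mul_ofReal_sub_one_le (x := z * x)
  rw [norm_sub_rev, Real.norm_eq_abs, abs_mul, abs_of_pos hx.1] at h
  rw [norm_mul, Complex.norm_real, Real.norm_of_nonneg (hnn x hx), ← mul_assoc]
  exact mul_le_mul_of_nonneg_right h (hnn x hx)

lemma re_one_sub_exp_mul_ofReal (u r : ℝ) :
    ((1 - Complex.exp (Complex.I * (u : ℂ))) * (r : ℂ)).re = (1 - Real.cos u) * r := by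
  rw [Complex.re_mul_ofReal, mul_comm Complex.I, Complex.sub_re, Complex.exp_ofReal_mul_I_re,
    Complex.one_re]

/-- if `ρ(x) ≥ 1/(c₁ x^{1+α₁})` a.e. on `(0,1]`, then for `|z| ≥ 1` one has
`∫₀¹ (1 − cos(zx)) ρ(x) dx ≥ |z|^{α₁}/(8c₁)`, and hence `A(z) = 1 + Re ψ(z) ≥ |z|^{α₁}/(8c₁)`. -/
theorem stmt10 (α₁ c₁ : ℝ) (hα₁ : 0 < α₁) (hα₁' : α₁ < 1) (hc₁ : 0 < c₁)
    (ρ : ℝ → ℝ) (hmeas : Measurable ρ)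
    (hnn : ∀ x ∈ Set.Ioc (0 : ℝ) 1, 0 ≤ ρ x)
    (hint : IntegrableOn (fun x => x * ρ x) (Set.Ioc (0 : ℝ) 1))
    (hlow : ∀ᵐ x ∂(volume.restrict (Set.Ioc (0 : ℝ) 1)), 1 / (c₁ * x ^ (1 + α₁)) ≤ ρ x)
    (z : ℝ) (hz : 1 ≤ |z|) :
    |z| ^ α₁ / (8 * c₁) ≤ ∫ x in Set.Ioc (0 : ℝ) 1, (1 - Real.cos (z * x)) * ρ x ∧
    |z| ^ α₁ / (8 * c₁) ≤ 1 + (subExp ρ z).re := by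
  have hC := integrableOn_subExp hmeas hnn hint z
  have hR : IntegrableOn (fun x => (1 - Real.cos (z * x)) * ρ x) (Set.Ioc (0 : ℝ) 1) := by
    simpa only [IntegrableOn, RCLike.re_eq_complex_re, re_one_sub_exp_mul_ofReal] using hC.re
  have hre : (subExp ρ z).re = ∫ x in Set.Ioc (0 : ℝ) 1, (1 - Real.cos (z * x)) * ρ x := by
    have h := integral_re hC
    simp only [RCLike.re_eq_complex_re, re_one_sub_exp_mul_ofReal] at h
    exact h.symm
  have hz0 : 0 < |z| := one_pos.trans_le hz
  have hb : 0 < |z|⁻¹ := inv_pos.mpr hz0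
  have hsub : Set.Ioc 0 |z|⁻¹ ⊆ Set.Ioc (0 : ℝ) 1 :=
    Set.Ioc_subset_Ioc_right (inv_le_one_of_one_le₀ hz)
  have hpow : IntegrableOn (fun x : ℝ => z ^ 2 / (4 * c₁) * x ^ (1 - α₁)) (Set.Ioc 0 |z|⁻¹) :=
    ((intervalIntegrable_iff_integrableOn_Ioc_of_le hb.le).mp
      (intervalIntegral.intervalIntegrable_rpow' (by linarith))).const_mul _
  have hval : ∫ x in Set.Ioc 0 |z|⁻¹, z ^ 2 / (4 * c₁) * x ^ (1 - α₁) =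
      |z| ^ α₁ / (4 * c₁ * (2 - α₁)) := by
    rw [integral_const_mul, ← intervalIntegral.integral_of_le hb.le,
      integral_rpow (Or.inl (by linarith)), Real.zero_rpow (by linarith), sub_zero,
      show 1 - α₁ + 1 = 2 - α₁ by ring, Real.inv_rpow hz0.le, ← Real.rpow_neg hz0.le,
      show -(2 - α₁) = α₁ - 2 by ring, Real.rpow_sub hz0, Real.rpow_two, sq_abs]
    have hzz : z ≠ 0 := abs_pos.mp hz0
    have h2 : 2 - α₁ ≠ 0 := by linarith
    field_simp
  have main : |z| ^ α₁ / (8 * c₁) ≤ ∫ x in Set.Ioc (0 : ℝ) 1, (1 - Real.cos (z * x)) * ρ x := by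
    calc |z| ^ α₁ / (8 * c₁) ≤ |z| ^ α₁ / (4 * c₁ * (2 - α₁)) := by
          apply div_le_div_of_nonneg_left (by positivity)
          · have : 0 < 2 - α₁ := by linarith
            positivity
          · nlinarith
      _ = ∫ x in Set.Ioc 0 |z|⁻¹, z ^ 2 / (4 * c₁) * x ^ (1 - α₁) := hval.symm
      _ ≤ ∫ x in Set.Ioc 0 |z|⁻¹, (1 - Real.cos (z * x)) * ρ x := by
          apply setIntegral_mono_ae_restrict hpow (hR.mono_set hsub)
          filter_upwards [ae_restrict_mem measurableSet_Ioc,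
            ae_restrict_of_ae_restrict_of_subset hsub hlow] with x hx hρ
          have hu : |z * x| ≤ 1 := by
            rw [abs_mul, abs_of_pos hx.1]
            calc |z| * x ≤ |z| * |z|⁻¹ := mul_le_mul_of_nonneg_left hx.2 hz0.le
              _ = 1 := mul_inv_cancel₀ hz0.ne'
          have hxp : x ^ (1 - α₁) = x ^ 2 / x ^ (1 + α₁) := by
            rw [← Real.rpow_two, ← Real.rpow_sub hx.1]
            ring_nf
          have hx0 : 0 < x ^ (1 + α₁) := Real.rpow_pos_of_pos hx.1 _
          calc z ^ 2 / (4 * c₁) * x ^ (1 - α₁)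
              = (z * x) ^ 2 / 4 * (1 / (c₁ * x ^ (1 + α₁))) := by
                rw [hxp]
                field_simp
            _ ≤ (1 - Real.cos (z * x)) * ρ x :=
                mul_le_mul (sq_div_four_le_one_sub_cos hu) hρ (by positivity)
                  (sub_nonneg.mpr (Real.cos_le_one _))
      _ ≤ ∫ x in Set.Ioc (0 : ℝ) 1, (1 - Real.cos (z * x)) * ρ x := by
          apply setIntegral_mono_set hR _ hsub.eventuallyLE
          filter_upwards [ae_restrict_mem measurableSet_Ioc] with x hx
          exact mul_nonneg (sub_nonneg.mpr (Real.cos_le_one _)) (hnn x hx)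
  refine ⟨main, ?_⟩
  rw [hre]
  linarith
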